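/- If Q = (x, y, z, u) and Q' = (x, y', z, u') are quadruples of generators of A sharing the same Artin–Schreier generators x and z, then there exist quadruples of generators Q₁ and Q₂ such that Q and Q₁ are related by a step of type Λ₁, Q₁ and Q₂ are related by a step of type Ω_s, and Q₂ and Q' are related by a step of type Λ₁. -/

import Mathlib

/-- `x` is an Artin–Schreier element: `x² + x ∈ F·1`. -/
def IsArtinSchreier (F : Type*) {A : Type*} [Field F] [Ring A] [Algebra F A] (x : A) : Prop :=
  x ^ 2 + x ∈ Set.range (algebraMap F A)

/-- `y` is a square-central element: `y² ∈ F·1`. -/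
def IsSquareCentral (F : Type*) {A : Type*} [Field F] [Ring A] [Algebra F A] (y : A) : Prop :=
  y ^ 2 ∈ Set.range (algebraMap F A)

/-- `(x, y, z, u)` is a quadruple of generators of the biquaternion algebra `A`. -/
def IsQuadruple (F : Type*) {A : Type*} [Field F] [Ring A] [Algebra F A]
    (q : A × A × A × A) : Prop :=
  match q with
  | (x, y, z, u) =>
    y ≠ 0 ∧ u ≠ 0 ∧
    IsArtinSchreier F x ∧ IsSquareCentral F y ∧
    IsArtinSchreier F z ∧ IsSquareCentral F u ∧
    x * y + y * x = y ∧ x * z = z * x ∧ x * u = u * x ∧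
    y * z = z * y ∧ y * u = u * y ∧ z * u + u * z = u

/-- Swapping the two pairs of a quadruple: `(x, y, z, u) ↦ (z, u, x, y)`. -/
def quadSwap {A : Type*} (q : A × A × A × A) : A × A × A × A :=
  (q.2.2.1, q.2.2.2, q.1, q.2.1)

/-- At least three of the four entries agree. -/
def AgreeThree {A : Type*} (q r : A × A × A × A) : Prop :=
  (q.1 = r.1 ∧ q.2.1 = r.2.1 ∧ q.2.2.1 = r.2.2.1) ∨
  (q.1 = r.1 ∧ q.2.1 = r.2.1 ∧ q.2.2.2 = r.2.2.2) ∨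
  (q.1 = r.1 ∧ q.2.2.1 = r.2.2.1 ∧ q.2.2.2 = r.2.2.2) ∨
  (q.2.1 = r.2.1 ∧ q.2.2.1 = r.2.2.1 ∧ q.2.2.2 = r.2.2.2)

/-- A step of type `Λ₁`: after possibly pair-swapping the target quadruple, at most one
generator is changed. -/
def Lambda1Step {A : Type*} (q q' : A × A × A × A) : Prop :=
  AgreeThree q q' ∨ AgreeThree q (quadSwap q')

/-- The relation underlying the `Ω_s` step: `x` and `z` are preserved and `y` and `u` are
multiplied by `a + b (x + z)` for some `a, b ∈ F`. -/
def OmegaSRel (F : Type*) {A : Type*} [Field F] [Ring A] [Algebra F A]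
    (q r : A × A × A × A) : Prop :=
  match q, r with
  | (x, y, z, u), (x', y', z', u') =>
    x' = x ∧ z' = z ∧ ∃ a b : F,
      y' = (a • (1 : A) + b • (x + z)) * y ∧ u' = (a • (1 : A) + b • (x + z)) * u

/-- A step of type `Ω_s`, up to pair-swapping the target quadruple. -/
def OmegaSStep (F : Type*) {A : Type*} [Field F] [Ring A] [Algebra F A]
    (q q' : A × A × A × A) : Prop :=
  OmegaSRel F q q' ∨ OmegaSRel F q (quadSwap q')

/-- The relation underlying the `Ω_i` step: `y` and `u` are preserved and an element of the
form `a·y·u` is added to `x` and `z` for some `a ∈ F`. -/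
def OmegaIRel (F : Type*) {A : Type*} [Field F] [Ring A] [Algebra F A]
    (q r : A × A × A × A) : Prop :=
  match q, r with
  | (x, y, z, u), (x', y', z', u') =>
    y' = y ∧ u' = u ∧ ∃ a : F, x' = x + a • (y * u) ∧ z' = z + a • (y * u)

/-- A step of type `Ω_i`, up to pair-swapping the target quadruple. -/
def OmegaIStep (F : Type*) {A : Type*} [Field F] [Ring A] [Algebra F A]
    (q q' : A × A × A × A) : Prop :=
  OmegaIRel F q q' ∨ OmegaIRel F q (quadSwap q')

/-- The relation underlying the `Ω_c` step: `y` and `z` are preserved, `x` changes to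
`x + b y (1 + b y)⁻¹ z` and `u` changes to `(1 + b y) u` for some `b ∈ F` with `1 + b y`
invertible. -/
def OmegaCRel (F : Type*) {A : Type*} [Field F] [DivisionRing A] [Algebra F A]
    (q r : A × A × A × A) : Prop :=
  match q, r with
  | (x, y, z, u), (x', y', z', u') =>
    y' = y ∧ z' = z ∧ ∃ b : F, IsUnit (1 + b • y) ∧
      x' = x + (b • y) * (1 + b • y)⁻¹ * z ∧ u' = (1 + b • y) * u

/-- A step of type `Ω_c`, up to pair-swapping the target quadruple. -/
def OmegaCStep (F : Type*) {A : Type*} [Field F] [DivisionRing A] [Algebra F A]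
    (q q' : A × A × A × A) : Prop :=
  OmegaCRel F q q' ∨ OmegaCRel F q (quadSwap q')

section

variable {F A : Type*} [Field F] [DivisionRing A] [Algebra F A]

/-- Adjoining to `S` an element `g` that does not commute with some `v` in the centralizer of `S`
at least halves the dimension of the centralizer. -/
theorem two_mul_finrank_centralizer_insert_le [FiniteDimensional F A] (S : Set A) (g v : A)
    (hv : v ∈ Subalgebra.centralizer F S) (hgv : g * v ≠ v * g) :
    2 * Module.finrank F (Subalgebra.centralizer F (insert g S)) ≤
      Module.finrank F (Subalgebra.centralizer F S) := by
  set K := Subalgebra.toSubmodule (Subalgebra.centralizer F (insert g S))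
  set W := Subalgebra.toSubmodule (Subalgebra.centralizer F S)
  have hv0 : v ≠ 0 := by rintro rfl; simp at hgv
  have hinj : Function.Injective (LinearMap.mulRight F v) :=
    fun a b h => mul_right_cancel₀ hv0 (by simpa using h)
  have hKW : K ≤ W := Subalgebra.centralizer_le F S (insert g S) (Set.subset_insert g S)
  have hmap : K.map (LinearMap.mulRight F v) ≤ W := by
    rintro _ ⟨a, ha, rfl⟩
    exact (Subalgebra.centralizer F S).mul_mem (hKW ha) hv
  have hdisj : K ⊓ K.map (LinearMap.mulRight F v) = ⊥ := by
    rw [eq_bot_iff]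
    rintro _ ⟨hb, a, ha, rfl⟩
    have h₁ : g * a = a * g := Subalgebra.mem_centralizer_iff F |>.1 ha g (Set.mem_insert g S)
    have h₂ : g * (a * v) = a * v * g :=
      Subalgebra.mem_centralizer_iff F |>.1 hb g (Set.mem_insert g S)
    have h₃ : a * (g * v) = a * (v * g) := by
      rw [← mul_assoc, ← h₁, mul_assoc, h₂, mul_assoc]
    have h₄ : a = 0 := by
      by_contra h
      exact hgv (mul_left_cancel₀ h h₃)
    simp [h₄]
  have hsum := Submodule.finrank_sup_add_finrank_inf_eq K (K.map (LinearMap.mulRight F v))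
  rw [hdisj, finrank_bot, add_zero,
    ← (Submodule.equivMapOfInjective _ hinj K).finrank_eq] at hsum
  have hle := Submodule.finrank_mono (sup_le hKW hmap)
  change 2 * Module.finrank F K ≤ Module.finrank F W
  lia

/-- In a 16-dimensional division algebra, only scalars commute with two commuting elements
`x`, `z` and with elements `y`, `u` detecting `x` and `z` respectively. -/
theorem mem_range_algebraMap_of_commute (hdim : Module.finrank F A = 16) {x y z u : A}
    (hxy : x * y ≠ y * x) (hxz : x * z = z * x) (hxu : x * u = u * x) (hyz : y * z = z * y)
    (hzu : z * u ≠ u * z) {c : A} (hx : x * c = c * x) (hy : y * c = c * y) (hz : z * c = c * z)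
    (hu : u * c = c * u) : c ∈ Set.range (algebraMap F A) := by
  have : FiniteDimensional F A := Module.finite_of_finrank_pos (by lia)
  have h₁ := two_mul_finrank_centralizer_insert_le (F := F) ∅ x y
    (by simp [Subalgebra.mem_centralizer_iff]) hxy
  have h₂ := two_mul_finrank_centralizer_insert_le (F := F) {x} z u
    (by simpa [Subalgebra.mem_centralizer_iff] using hxu) hzu
  have h₃ := two_mul_finrank_centralizer_insert_le (F := F) {z, x} y x
    (by simpa [Subalgebra.mem_centralizer_iff] using hxz.symm) hxy.symm
  have h₄ := two_mul_finrank_centralizer_insert_le (F := F) {y, z, x} u z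
    (by simpa [Subalgebra.mem_centralizer_iff] using ⟨hyz, hxz⟩) hzu.symm
  have h₀ := Submodule.finrank_le (Subalgebra.toSubmodule (Subalgebra.centralizer F (∅ : Set A)))
  rw [Subalgebra.finrank_toSubmodule] at h₀
  rw [← Set.singleton_def] at h₁
  have hpos := Module.finrank_pos (R := F) (M := Subalgebra.centralizer F ({u, y, z, x} : Set A))
  have hbot := Subalgebra.eq_bot_of_finrank_one
    (S := Subalgebra.centralizer F ({u, y, z, x} : Set A)) (by lia)
  have hc : c ∈ Subalgebra.centralizer F ({u, y, z, x} : Set A) := by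
    simp [Subalgebra.mem_centralizer_iff, hx, hy, hz, hu]
  rw [hbot] at hc
  exact Algebra.mem_bot.1 hc

theorem mul_ne_mul_of_mul_add_mul_eq [CharP A 2] {p q : A} (hq : q ≠ 0)
    (h : p * q + q * p = q) : p * q ≠ q * p := by
  intro hpq
  rw [hpq, CharTwo.add_self_eq_zero] at h
  exact hq h.symm

theorem mul_sq_eq_sq_mul_of_mul_add_mul_eq [CharP A 2] {p q : A} (h : p * q + q * p = q) :
    p * q ^ 2 = q ^ 2 * p := by
  have h' : p * q = q + q * p := CharTwo.add_eq_iff_eq_add.1 h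
  rw [pow_two, ← mul_assoc, h', add_mul, mul_assoc, h', mul_add, ← add_assoc,
    CharTwo.add_self_eq_zero, zero_add, mul_assoc]

/-- Square-centrality of `y` and `u` is a consequence of the other relations. -/
theorem isQuadruple_of_commute [CharP A 2] (hdim : Module.finrank F A = 16) {x y z u : A}
    (hy : y ≠ 0) (hu : u ≠ 0) (hx : IsArtinSchreier F x) (hz : IsArtinSchreier F z)
    (hxy : x * y + y * x = y) (hxz : x * z = z * x) (hxu : x * u = u * x) (hyz : y * z = z * y)
    (hyu : y * u = u * y) (hzu : z * u + u * z = u) : IsQuadruple F (x, y, z, u) := by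
  have hxy' := mul_ne_mul_of_mul_add_mul_eq hy hxy
  have hzu' := mul_ne_mul_of_mul_add_mul_eq hu hzu
  refine ⟨hy, hu, hx, ?_, hz, ?_, hxy, hxz, hxu, hyz, hyu, hzu⟩
  · exact mem_range_algebraMap_of_commute hdim hxy' hxz hxu hyz hzu'
      (mul_sq_eq_sq_mul_of_mul_add_mul_eq hxy) (Commute.self_pow y 2)
      (Commute.pow_right (Eq.symm hyz) 2) (Commute.pow_right (Eq.symm hyu) 2)
  · exact mem_range_algebraMap_of_commute hdim hxy' hxz hxu hyz hzu' (Commute.pow_right hxu 2)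
      (Commute.pow_right hyu 2) (mul_sq_eq_sq_mul_of_mul_add_mul_eq hzu) (Commute.self_pow u 2)

theorem mul_add_mul_add_eq [CharP A 2] {x y z t e : A} (hxy : x * y + y * x = y)
    (hyz : y * z = z * y) (hye : y * e = e * y) (hyt : y * t = (t + e) * y) :
    y * (t + e * (x + z)) = (t + e * (x + z)) * y := by
  have hyx : y * x = x * y + y := by
    rw [add_comm] at hxy
    rw [CharTwo.add_eq_iff_eq_add.1 hxy, add_comm]
  have h₂ : e * y + e * y = 0 := CharTwo.add_self_eq_zero _
  rw [mul_add, hyt, ← mul_assoc, hye, mul_assoc, mul_add, hyx, hyz]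
  simp only [mul_add, add_mul, mul_assoc]
  linear_combination (norm := abel) h₂

/-- If `y` and `u`, which shift the commuting elements `x` and `z` respectively, both invert by
conjugation an element `t` commuting with `x` and `z`, then `t` lies in `F + F (x + z)`. -/
theorem exists_eq_smul_one_add_smul_add [CharP A 2] (hdim : Module.finrank F A = 16)
    {x y z u t : A} (hy : y ≠ 0) (hu : u ≠ 0) (hxy : x * y + y * x = y) (hxz : x * z = z * x)
    (hxu : x * u = u * x) (hyz : y * z = z * y) (hzu : z * u + u * z = u)
    (ht : t ≠ 0) (hxt : x * t = t * x) (hzt : z * t = t * z) (hyt : y * t = t⁻¹ * y)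
    (hut : u * t = t⁻¹ * u) : ∃ a b : F, t = a • (1 : A) + b • (x + z) := by
  have hxy' := mul_ne_mul_of_mul_add_mul_eq hy hxy
  have hzu' := mul_ne_mul_of_mul_add_mul_eq hu hzu
  have conj_inv {v : A} (hv : v * t = t⁻¹ * v) : v * t⁻¹ = t * v := by
    rw [← mul_inv_cancel_left₀ ht (v * t⁻¹), ← mul_assoc t⁻¹, ← hv, mul_inv_cancel_right₀ ht]
  have hxt' : x * t⁻¹ = t⁻¹ * x := Commute.inv_right₀ hxt
  have hzt' : z * t⁻¹ = t⁻¹ * z := Commute.inv_right₀ hzt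
  obtain ⟨d, hd⟩ := mem_range_algebraMap_of_commute (F := F) hdim hxy' hxz hxu hyz hzu'
    (c := t + t⁻¹) (by rw [mul_add, add_mul, hxt, hxt'])
    (by rw [mul_add, add_mul, hyt, conj_inv hyt, add_comm])
    (by rw [mul_add, add_mul, hzt, hzt'])
    (by rw [mul_add, add_mul, hut, conj_inv hut, add_comm])
  have hinv : t⁻¹ = t + algebraMap F A d := by
    rw [hd, ← add_assoc, CharTwo.add_self_eq_zero, zero_add]
  rw [hinv] at hyt hut
  have hdc (a : A) : a * algebraMap F A d = algebraMap F A d * a := (Algebra.commutes d a).symm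
  obtain ⟨f, hf⟩ := mem_range_algebraMap_of_commute (F := F) hdim hxy' hxz hxu hyz hzu'
    (c := t + algebraMap F A d * (x + z))
    (Commute.add_right hxt (Commute.mul_right (hdc x) (Commute.add_right (Commute.refl x) hxz)))
    (mul_add_mul_add_eq hxy hyz (hdc y) hyt)
    (Commute.add_right hzt
      (Commute.mul_right (hdc z) (Commute.add_right (Eq.symm hxz) (Commute.refl z))))
    (by rw [add_comm x]; exact mul_add_mul_add_eq hzu hxu.symm (hdc u) hut)
  refine ⟨f, d, ?_⟩
  rw [Algebra.smul_def, mul_one, hf, Algebra.smul_def, add_assoc, CharTwo.add_self_eq_zero,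
    add_zero]

/-- Hilbert's Theorem 90 for the commutator of `u` and `y`, with an explicit solution. -/
theorem exists_conj_eq_conj [CharP A 2] (hdim : Module.finrank F A = 16)
    {x y z u : A} (hy : y ≠ 0) (hu : u ≠ 0) (hxy : x * y + y * x = y) (hxz : x * z = z * x)
    (hxu : x * u = u * x) (hyz : y * z = z * y) (hzu : z * u + u * z = u)
    (hy2 : IsSquareCentral F y) (hu2 : IsSquareCentral F u) :
    ∃ w : A, w ≠ 0 ∧ (∃ a b : F, w = a • (1 : A) + b • (x + z)) ∧
      u * w * y = w * y * u ∧ y * w⁻¹ * u = w⁻¹ * u * y := by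
  by_cases hcomm : u * y = y * u
  · exact ⟨1, one_ne_zero, ⟨1, 0, by simp⟩, by simpa using hcomm, by simpa using hcomm.symm⟩
  obtain ⟨p, hp⟩ := hy2
  obtain ⟨q, hq⟩ := hu2
  have hyu0 : y * u ≠ 0 := mul_ne_zero hy hu
  obtain ⟨t, ht⟩ : ∃ t, t * (y * u) = u * y :=
    ⟨u * y * (y * u)⁻¹, inv_mul_cancel_right₀ hyu0 _⟩
  have ht0 : t ≠ 0 := by rintro rfl; simp [eq_comm, hu, hy] at ht
  have shift {a b c : A} (h₁ : a * b + b * a = b) (h₂ : a * c = c * a) :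
      a * (b * c) = (b * c) * (a + 1) ∧ a * (c * b) = (c * b) * (a + 1) := by
    have h : a * b = b * (a + 1) := by
      rw [CharTwo.add_eq_iff_eq_add.1 h₁, mul_add, mul_one, add_comm]
    have h₃ : (a + 1) * c = c * (a + 1) := by rw [add_mul, mul_add, h₂, one_mul, mul_one]
    exact ⟨by rw [← mul_assoc, h, mul_assoc, h₃, mul_assoc],
      by rw [← mul_assoc, h₂, mul_assoc, h, mul_assoc]⟩
  have comm_t {a : A} (h₁ : a * (u * y) = (u * y) * (a + 1))
      (h₂ : a * (y * u) = (y * u) * (a + 1)) : a * t = t * a := by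
    apply mul_right_cancel₀ hyu0
    rw [mul_assoc, ht, h₁, mul_assoc t, h₂, ← mul_assoc t, ht]
  have hxt : x * t = t * x := comm_t (shift hxy hxu).2 (shift hxy hxu).1
  have hzt : z * t = t * z := comm_t (shift hzu hyz.symm).1 (shift hzu hyz.symm).2
  have hyu : t⁻¹ * (u * y) = y * u := by rw [← ht, inv_mul_cancel_left₀ ht0]
  have hyt : y * t = t⁻¹ * y := by
    apply mul_right_cancel₀ hyu0
    rw [mul_assoc, ht, mul_assoc, ← mul_assoc y y u, ← pow_two, ← hp, Algebra.commutes,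
      hp, pow_two, ← mul_assoc, ← hyu]
    simp only [mul_assoc]
  have hut : u * t = t⁻¹ * u := by
    apply mul_right_cancel₀ hyu0
    rw [mul_assoc, ht, ← mul_assoc, ← pow_two, ← hq, Algebra.commutes, hq, pow_two, ← mul_assoc,
      mul_assoc t⁻¹, ← mul_assoc u y, ← mul_assoc t⁻¹, hyu]
  obtain ⟨a, b, hab⟩ := exists_eq_smul_one_add_smul_add hdim hy hu hxy hxz hxu hyz hzu ht0 hxt
    hzt hyt hut
  have hw0 : 1 + t ≠ 0 := by
    intro h
    rw [CharTwo.add_eq_zero] at h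
    rw [← h, one_mul] at ht
    exact hcomm ht.symm
  have conj {v : A} (hv : v * t = t⁻¹ * v) : t * (v * (1 + t)) = (1 + t) * v := by
    rw [mul_add, hv, mul_add, mul_inv_cancel_left₀ ht0, mul_one, add_mul, one_mul, add_comm]
  have htw : (1 + t) * t = t * (1 + t) := by rw [add_mul, mul_add, one_mul, mul_one]
  refine ⟨1 + t, hw0, ⟨1 + a, b, ?_⟩, ?_, ?_⟩
  · conv_lhs => rw [hab]
    rw [add_smul, one_smul, add_assoc]
  · apply mul_left_cancel₀ ht0
    rw [← mul_assoc, conj hut, mul_assoc, ← ht, ← mul_assoc, htw]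
    simp only [mul_assoc]
  · apply mul_left_cancel₀ hw0
    have h : (1 + t) * (y * (1 + t)⁻¹) = t * y := by
      rw [← mul_assoc, ← conj hyt, ← mul_assoc, mul_inv_cancel_right₀ hw0]
    rw [← mul_assoc, h, mul_assoc, ht, mul_assoc, mul_inv_cancel_left₀ hw0]

end

/-- A step of type `Λ₂` preserving the two Artin–Schreier generators can be achieved by a
`Λ₁` step, followed by an `Ω_s` step, followed by a `Λ₁` step. -/
theorem lambda2_separable_eq_lambda1_omegaS_lambda1 (F A : Type*) [Field F] [CharP F 2]
    [DivisionRing A] [Algebra F A]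
    (hcentral : Subalgebra.center F A = ⊥) (hdim : Module.finrank F A = 16)
    (hbiquat : ∃ q : A × A × A × A, IsQuadruple F q)
    (x y z u y' u' : A)
    (hQ : IsQuadruple F (x, y, z, u)) (hQ' : IsQuadruple F (x, y', z, u')) :
    ∃ Q₁ Q₂ : A × A × A × A, IsQuadruple F Q₁ ∧ IsQuadruple F Q₂ ∧
      Lambda1Step (x, y, z, u) Q₁ ∧ OmegaSStep F Q₁ Q₂ ∧ Lambda1Step Q₂ (x, y', z, u') := by
  have : CharP A 2 := charP_of_injective_algebraMap (algebraMap F A).injective 2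
  obtain ⟨hy, hu, hx, hy2, hz, -, hxy, hxz, hxu, hyz, hyu, hzu⟩ := hQ
  obtain ⟨hy', hu', -, -, -, hu2', -, -, hxu', -, -, hzu'⟩ := hQ'
  obtain ⟨w, hw0, ⟨a, b, hab⟩, hwy, hwu⟩ :=
    exists_conj_eq_conj hdim hy hu' hxy hxz hxu' hyz hzu' hy2 hu2'
  have hxw : x * w = w * x := by
    rw [hab]
    exact Commute.add_right ((Commute.one_right x).smul_right a)
      ((Commute.add_right (Commute.refl x) hxz).smul_right b)
  have hzw : z * w = w * z := by
    rw [hab]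
    exact Commute.add_right ((Commute.one_right z).smul_right a)
      ((Commute.add_right (Eq.symm hxz) (Commute.refl z)).smul_right b)
  have hxw' : x * w⁻¹ = w⁻¹ * x := Commute.inv_right₀ hxw
  have hzw' : z * w⁻¹ = w⁻¹ * z := Commute.inv_right₀ hzw
  refine ⟨(x, y, z, w⁻¹ * u'), (x, w * y, z, u'), ?_, ?_, ?_, ?_, ?_⟩
  · refine isQuadruple_of_commute hdim hy (mul_ne_zero (inv_ne_zero hw0) hu') hx hz hxy hxz
      (Commute.mul_right hxw' hxu') hyz ?_ ?_
    · rw [← mul_assoc, hwu]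
    · rw [← mul_assoc, hzw', mul_assoc, mul_assoc, ← mul_add, hzu']
  · refine isQuadruple_of_commute hdim (mul_ne_zero hw0 hy) hu' hx hz ?_ hxz hxu'
      (Commute.mul_left (Eq.symm hzw) hyz) ?_ hzu'
    · rw [← mul_assoc, hxw, mul_assoc, mul_assoc, ← mul_add, hxy]
    · rw [← hwy, mul_assoc]
  · exact Or.inl (Or.inl ⟨rfl, rfl, rfl⟩)
  · refine Or.inl ⟨rfl, rfl, a, b, ?_, ?_⟩
    · rw [hab]
    · rw [← hab, mul_inv_cancel_left₀ hw0]
  · exact Or.inl (Or.inr (Or.inr (Or.inl ⟨rfl, rfl, rfl⟩)))
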